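/- arXiv:1208.4854 — 3 statements merged into one kernel-verified Lean document; each statement's English description precedes it below -/
import Mathlib

section
/- For every integer n ≥ 1, the average of f(π) over all deals π ∈ D_n (i.e., (∑_{π ∈ D_n} f(π)) / |D_n|, as a real number) equals 2^(2n) / (2n choose n). In other words, the expected position of the first match in a random deal of 2n cards is 4^n / C(2n,n). -/
open scoped Classical

/-- A deal of size `n` is a fixed-point-free involution of `Fin (2*n)`. -/
def IsDeal (n : ℕ) (π : Fin (2*n) → Fin (2*n)) : Prop :=
  ∀ j, π (π j) = j ∧ π j ≠ j

/-- The finite set `D_n` of all deals of size `n`. -/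
noncomputable def deals (n : ℕ) : Finset (Fin (2*n) → Fin (2*n)) :=
  Finset.univ.filter (IsDeal n)

/-- `f(π)`: the 1-indexed position of the first card matching an earlier card,
i.e. `1 + min { j : π j < j }` (positions 0-indexed). -/
noncomputable def firstMatch {n : ℕ} (π : Fin (2*n) → Fin (2*n)) : ℕ :=
  1 + sInf {j : ℕ | ∃ h : j < 2*n, (π ⟨j, h⟩).val < j}

/-- The involutions of `α` whose non-fixed points are exactly the elements of `S` and which match
no two elements of `A`. -/
noncomputable def independentMatchings {α : Type*} [Fintype α] (S A : Finset α) :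
    Finset (α → α) :=
  Finset.univ.filter fun π =>
    (∀ x, π (π x) = x) ∧ (∀ x, π x ≠ x ↔ x ∈ S) ∧ ∀ x ∈ A, π x ∉ A

theorem mem_independentMatchings {α : Type*} [Fintype α] {S A : Finset α} {π : α → α} :
    π ∈ independentMatchings S A ↔
      (∀ x, π (π x) = x) ∧ (∀ x, π x ≠ x ↔ x ∈ S) ∧ ∀ x ∈ A, π x ∉ A := by
  simp [independentMatchings]

/-- Removing the pair `{a, b}` from a matching. -/
theorem card_filter_independentMatchings_insert {α : Type*} [Fintype α] {S A : Finset α} {a b : α}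
    (ha : a ∈ S) (haA : a ∉ A) (hb : b ∈ S \ insert a A) :
    ((independentMatchings S (insert a A)).filter fun π => π a = b).card
      = (independentMatchings (S \ {a, b}) A).card := by
  have hab : a ≠ b := by grind
  refine Finset.card_nbij' (fun π x => Equiv.swap a b (π x)) (fun π x => Equiv.swap a b (π x))
    ?_ ?_ ?_ ?_
  · intro π hπ
    simp only [Finset.coe_filter, Set.mem_ofPred_eq, Finset.mem_coe,
      mem_independentMatchings] at hπ ⊢
    obtain ⟨⟨h1, h2, h3⟩, h4⟩ := hπ
    have h5 : π b = a := by rw [← h4, h1]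
    simp only [Equiv.swap_apply_def]
    refine ⟨?_, ?_, ?_⟩ <;> intro x <;> have := h1 x <;> have := h2 x <;> have := h3 x <;> grind
  · intro π hπ
    simp only [Finset.coe_filter, Set.mem_ofPred_eq, Finset.mem_coe,
      mem_independentMatchings] at hπ ⊢
    obtain ⟨h1, h2, h3⟩ := hπ
    have h4 : π a = a := by have := h2 a; grind
    have h5 : π b = b := by have := h2 b; grind
    simp only [Equiv.swap_apply_def]
    refine ⟨⟨?_, ?_, ?_⟩, by grind⟩ <;> intro x <;> have := h1 x <;> have := h2 x <;>
      have := h3 x <;> grind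
  · intro π _
    simp
  · intro π _
    simp

theorem card_independentMatchings_insert {α : Type*} [Fintype α] {S A : Finset α} {a : α}
    (ha : a ∈ S) (haA : a ∉ A) :
    (independentMatchings S (insert a A)).card
      = ∑ b ∈ S \ insert a A, (independentMatchings (S \ {a, b}) A).card := by
  rw [Finset.card_eq_sum_card_fiberwise (f := fun π => π a) (t := S \ insert a A)]
  · exact Finset.sum_congr rfl fun b hb =>
      card_filter_independentMatchings_insert ha haA hb
  · intro π hπ
    obtain ⟨h1, h2, h3⟩ := mem_independentMatchings.1 (Finset.mem_coe.1 hπ)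
    have := h1 a
    have := h2 a
    have := h2 (π a)
    have := h3 a
    simp only [Finset.coe_sdiff, Set.mem_sdiff, Finset.mem_coe]
    grind

theorem card_independentMatchings_mul {α : Type*} [Fintype α] (j k : ℕ) (S A : Finset α)
    (hA : A ⊆ S) (hS : S.card = 2 * j + 2 * k) (hk : A.card = k) :
    (independentMatchings S A).card * (2 ^ j * j.factorial) = (k + 2 * j).factorial := by
  induction j generalizing k S A with
  | zero =>
    induction k generalizing S A with
    | zero =>
      obtain rfl : A = ∅ := Finset.card_eq_zero.1 hk
      obtain rfl : S = ∅ := Finset.card_eq_zero.1 (by omega)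
      have : independentMatchings (∅ : Finset α) ∅ = {id} := by
        ext π
        simp only [mem_independentMatchings, Finset.mem_singleton, funext_iff]
        simp
        grind
      simp [this]
    | succ k ih =>
      obtain ⟨a, B, haB, rfl, hB⟩ := Finset.card_eq_succ.1 hk
      have haS : a ∈ S := hA (Finset.mem_insert_self _ _)
      have hBS : B ⊆ S := (Finset.subset_insert _ _).trans hA
      rw [card_independentMatchings_insert haS haB, Finset.sum_mul,
        Finset.sum_congr rfl fun b hb => ih (S \ {a, b}) B (by grind) ?_ hB]
      · rw [Finset.sum_const, Finset.card_sdiff_of_subset hA, hS, hk, smul_eq_mul,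
          show 2 * 0 + 2 * (k + 1) - (k + 1) = k + 1 by omega]
        simp [Nat.factorial_succ]
      · rw [Finset.card_sdiff_of_subset (by grind), Finset.card_pair (by grind), hS]
        omega
  | succ j ihj =>
    induction k generalizing S A with
    | zero =>
      obtain rfl : A = ∅ := Finset.card_eq_zero.1 hk
      obtain ⟨a, ha⟩ : S.Nonempty := Finset.card_pos.1 (by omega)
      have h : independentMatchings S ∅ = independentMatchings S {a} := by
        ext π
        simp only [mem_independentMatchings]
        grind
      have := ihj 1 S {a} (by simpa using ha) (by omega) (by simp)
      rw [h, show 0 + 2 * (j + 1) = (1 + 2 * j) + 1 by ring, Nat.factorial_succ (1 + 2 * j),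
        ← this, Nat.factorial_succ]
      ring
    | succ k ih =>
      obtain ⟨a, B, haB, rfl, hB⟩ := Finset.card_eq_succ.1 hk
      have haS : a ∈ S := hA (Finset.mem_insert_self _ _)
      have hBS : B ⊆ S := (Finset.subset_insert _ _).trans hA
      rw [card_independentMatchings_insert haS haB, Finset.sum_mul,
        Finset.sum_congr rfl fun b hb => ih (S \ {a, b}) B (by grind) ?_ hB]
      · rw [Finset.sum_const, Finset.card_sdiff_of_subset hA, hS, hk, smul_eq_mul,
          show 2 * (j + 1) + 2 * (k + 1) - (k + 1) = k + 2 * (j + 1) + 1 by omega,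
          show k + 1 + 2 * (j + 1) = k + 2 * (j + 1) + 1 by omega, Nat.factorial_succ]
      · rw [Finset.card_sdiff_of_subset (by grind), Finset.card_pair (by grind), hS]
        omega

theorem sum_choose_add_div_two_pow (n : ℕ) :
    ∑ j ∈ Finset.range (n + 1), ((n + j).choose j : ℝ) / 2 ^ j = 2 ^ n := by
  induction n with
  | zero => simp
  | succ n ih =>
    have hpascal : ∑ j ∈ Finset.range (n + 2), ((n + 1 + j).choose j : ℝ) / 2 ^ j
        = ∑ j ∈ Finset.range (n + 2), ((n + j).choose j : ℝ) / 2 ^ j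
          + (∑ j ∈ Finset.range (n + 1), ((n + 1 + j).choose j : ℝ) / 2 ^ j) / 2 := by
      rw [Finset.sum_range_succ' (fun j => ((n + 1 + j).choose j : ℝ) / 2 ^ j),
        Finset.sum_range_succ' (fun j => ((n + j).choose j : ℝ) / 2 ^ j), Finset.sum_div,
        add_right_comm (∑ j ∈ Finset.range (n + 1), _), ← Finset.sum_add_distrib]
      congr 1
      · refine Finset.sum_congr rfl fun j _ => ?_
        rw [show n + 1 + (j + 1) = (n + 1 + j) + 1 by ring, Nat.choose_succ_succ,
          show n + (j + 1) = n + 1 + j by ring]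
        push_cast
        ring
      · simp
    have hcentral : ((n + 1 + (n + 1)).choose (n + 1) : ℝ) = 2 * (n + (n + 1)).choose (n + 1) := by
      have h : (n + (n + 1)).choose n = (n + (n + 1)).choose (n + 1) :=
        Nat.choose_symm_of_eq_add rfl
      rw [show n + 1 + (n + 1) = (n + (n + 1)) + 1 by ring, Nat.choose_succ_succ, h]
      push_cast
      ring
    have hlast := Finset.sum_range_succ (fun j => ((n + 1 + j).choose j : ℝ) / 2 ^ j) (n + 1)
    rw [Finset.sum_range_succ (fun j => ((n + j).choose j : ℝ) / 2 ^ j) (n + 1), ih] at hpascal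
    simp only [hcentral, mul_div_assoc] at hlast
    rw [pow_succ]
    linarith

theorem lt_firstMatch_iff {n : ℕ} (hn : 1 ≤ n) {π : Fin (2 * n) → Fin (2 * n)}
    (hπ : IsDeal n π) (k : ℕ) :
    k < firstMatch π ↔ ∀ x : Fin (2 * n), x.val < k → k ≤ (π x).val := by
  have hne : {j : ℕ | ∃ h : j < 2 * n, (π ⟨j, h⟩).val < j}.Nonempty := by
    have h0 := hπ ⟨0, by omega⟩
    refine ⟨(π ⟨0, by omega⟩).val, Fin.isLt _, ?_⟩
    rw [Fin.eta, h0.1]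
    exact Nat.pos_of_ne_zero fun h => h0.2 (Fin.ext h)
  rw [firstMatch, Nat.lt_one_add_iff]
  constructor
  · intro h x hx
    by_contra! hlt
    have hinv := hπ x
    rcases lt_or_gt_of_ne hinv.2 with hc | hc
    · exact absurd (h.trans (Nat.sInf_le ⟨x.isLt, hc⟩)) (by omega)
    · exact absurd (h.trans (Nat.sInf_le ⟨(π x).isLt, by rw [Fin.eta, hinv.1]; exact hc⟩))
        (by omega)
  · intro h
    refine le_csInf hne ?_
    rintro j ⟨hj, hlt⟩
    by_contra! hjk
    have := h ⟨j, hj⟩ hjk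
    omega

theorem firstMatch_le {n : ℕ} (hn : 1 ≤ n) {π : Fin (2 * n) → Fin (2 * n)} (hπ : IsDeal n π) :
    firstMatch π ≤ n + 1 := by
  by_contra! h
  rw [lt_firstMatch_iff hn hπ] at h
  have hinj : Function.Injective π := Function.LeftInverse.injective fun x => (hπ x).1
  have hcard := Finset.card_le_card_of_injOn
    (s := Finset.univ.filter fun x : Fin (2 * n) => x.val < n + 1)
    (t := Finset.univ.filter fun x : Fin (2 * n) => ¬ x.val < n + 1) π
    (fun x hx => by simpa using h x (by simpa using hx)) hinj.injOn
  have hsum := Finset.card_filter_add_card_filter_not (s := (Finset.univ : Finset (Fin (2 * n))))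
    (fun x => x.val < n + 1)
  rw [Fin.card_filter_val_lt, Finset.card_univ, Fintype.card_fin] at hsum
  rw [Fin.card_filter_val_lt] at hcard
  omega

theorem card_filter_lt_firstMatch {n : ℕ} (hn : 1 ≤ n) {j k : ℕ} (hjk : j + k = n) :
    (((deals n).filter fun π => k < firstMatch π).card : ℝ)
      = n.factorial * (((n + j).choose j : ℝ) / 2 ^ j) := by
  have heq : ((deals n).filter fun π => k < firstMatch π)
      = independentMatchings Finset.univ (Finset.univ.filter fun x : Fin (2 * n) => x.val < k) := by
    ext π
    simp only [deals, Finset.mem_filter, Finset.mem_univ, true_and, mem_independentMatchings,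
      iff_true, not_lt]
    constructor
    · rintro ⟨hπ, hk⟩
      exact ⟨fun x => (hπ x).1, fun x => (hπ x).2, (lt_firstMatch_iff hn hπ k).1 hk⟩
    · rintro ⟨h1, h2, h3⟩
      exact ⟨fun x => ⟨h1 x, h2 x⟩, (lt_firstMatch_iff hn (fun x => ⟨h1 x, h2 x⟩) k).2 h3⟩
  have hcard := card_independentMatchings_mul j k Finset.univ
    (Finset.univ.filter fun x : Fin (2 * n) => x.val < k) (Finset.subset_univ _)
    (by rw [Finset.card_univ, Fintype.card_fin]; omega)
    (by rw [Fin.card_filter_val_lt]; omega)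
  have hchoose := Nat.add_choose_mul_factorial_mul_factorial n j
  rw [← heq, show k + 2 * j = n + j by omega, ← hchoose] at hcard
  have hj : (j.factorial : ℝ) ≠ 0 := by exact_mod_cast j.factorial_ne_zero
  have hcast : (((deals n).filter fun π => k < firstMatch π).card : ℝ) * (2 ^ j * j.factorial)
      = (n + j).choose j * n.factorial * j.factorial := by
    exact_mod_cast hcard
  field_simp
  apply mul_right_cancel₀ hj
  linarith

theorem card_deals {n : ℕ} (hn : 1 ≤ n) :
    ((deals n).card : ℝ) = n.factorial * (((2 * n).choose n : ℝ) / 2 ^ n) := by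
  have h := card_filter_lt_firstMatch hn (add_zero n)
  rwa [Finset.filter_true_of_mem fun π _ => by simp [firstMatch], ← two_mul] at h

theorem sum_firstMatch {n : ℕ} (hn : 1 ≤ n) :
    ∑ π ∈ deals n, (firstMatch π : ℝ) = n.factorial * 2 ^ n := by
  have h1 : ∀ π ∈ deals n, (firstMatch π : ℝ)
      = ∑ k ∈ Finset.range (n + 1), if k < firstMatch π then (1 : ℝ) else 0 := by
    intro π hπ
    have hle := firstMatch_le hn (Finset.mem_filter.1 hπ).2
    have hfilter : (Finset.range (n + 1)).filter (· < firstMatch π)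
        = Finset.range (firstMatch π) := by
      ext k
      simp only [Finset.mem_filter, Finset.mem_range]
      omega
    rw [Finset.sum_boole, hfilter, Finset.card_range]
  rw [Finset.sum_congr rfl h1, Finset.sum_comm, ← sum_choose_add_div_two_pow n, Finset.mul_sum,
    ← Finset.sum_range_reflect]
  refine Finset.sum_congr rfl fun j hj => ?_
  rw [Finset.sum_boole, ← card_filter_lt_firstMatch hn]
  have := Finset.mem_range.1 hj
  omega

/-- The expected position of the first match in a random deal of `2n` cards
is `2^(2n) / (2n choose n)`. -/
theorem expected_firstMatch (n : ℕ) (hn : 1 ≤ n) :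
    (∑ π ∈ deals n, (firstMatch π : ℝ)) / ((deals n).card : ℝ)
      = 2^(2*n) / (Nat.choose (2*n) n : ℝ) := by
  have hfac : (n.factorial : ℝ) ≠ 0 := by exact_mod_cast n.factorial_ne_zero
  have hchoose : ((2 * n).choose n : ℝ) ≠ 0 := by
    exact_mod_cast (Nat.choose_pos (by omega)).ne'
  rw [sum_firstMatch hn, card_deals hn]
  field_simp
  ring
end

section
/- For every integer n ≥ 1, eb(n,1) = (2n − 2)/3; equivalently, db(n,1) = −1. That is, the expected number of blocks of length 1 in a random deal of size n equals (2n+1)/3 − 1. -/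
open scoped Classical

/-- The second occurrences of `π` (positions `j` with `π j < j`), in
increasing order: `j_1 < j_2 < ... < j_n`. -/
def blockEnds {n : ℕ} (π : Fin (2*n) → Fin (2*n)) : List (Fin (2*n)) :=
  (Finset.univ.filter (fun j => π j < j)).sort (· ≤ ·)

/-- The block lengths `b_1, ..., b_n` of a deal:
`b_1 = j_1 + 1` and `b_i = j_i - j_(i-1)` for `i ≥ 2`. -/
def blockLens {n : ℕ} (π : Fin (2*n) → Fin (2*n)) : List ℕ :=
  List.zipWith (fun x y => x - y)
    ((blockEnds π).map (fun j => (j : ℕ) + 1))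
    (0 :: (blockEnds π).map (fun j => (j : ℕ) + 1))

/-- The blocks of a deal: each block length `b_i` paired with the ending
position `j_i` of the block. -/
def blocks {n : ℕ} (π : Fin (2*n) → Fin (2*n)) : List (ℕ × Fin (2*n)) :=
  List.zip (blockLens π) (blockEnds π)

/-- The `i`-th block (ending at position `j_i`) is lucky if `π j_i = j_i - 1`. -/
def IsLuckyEnd {n : ℕ} (π : Fin (2*n) → Fin (2*n)) (j : Fin (2*n)) : Prop :=
  (π j).val = (j : ℕ) - 1

/-- `b(n,j)`: total number of blocks of length `j` over all deals in `D_n`. -/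
noncomputable def bcount (n j : ℕ) : ℕ :=
  ∑ π ∈ deals n, (blockLens π).count j

/-- `l(n,j)`: total number of lucky blocks of length `j` over all deals in `D_n`. -/
noncomputable def lcount (n j : ℕ) : ℕ :=
  ∑ π ∈ deals n, (blocks π).countP (fun p => decide (p.1 = j ∧ IsLuckyEnd π p.2))

/-- `eb(n,j)`: the expected number of blocks of length `j` in a random deal. -/
noncomputable def eb (n j : ℕ) : ℝ := (bcount n j : ℝ) / ((deals n).card : ℝ)

/-- `el(n,j)`: the expected number of lucky blocks of length `j` in a random deal. -/
noncomputable def el (n j : ℕ) : ℝ := (lcount n j : ℝ) / ((deals n).card : ℝ)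

/-- `db(n,j) = eb(n,j) - 2(2n+1)/(j(j+1)(j+2))`. -/
noncomputable def db (n j : ℕ) : ℝ :=
  eb n j - 2*(2*(n:ℝ)+1) / ((j:ℝ) * ((j:ℝ)+1) * ((j:ℝ)+2))

/-- `dl(n,j) = el(n,j) - 1/(j(j-1))`. -/
noncomputable def dl (n j : ℕ) : ℝ :=
  el n j - 1 / ((j:ℝ) * ((j:ℝ)-1))

/-- `e(π)`: the number of blocks of `π` of even length. -/
noncomputable def evenBlocks {n : ℕ} (π : Fin (2*n) → Fin (2*n)) : ℕ :=
  (blockLens π).countP (fun b => decide (Even b))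

/-- `l(π)`: the number of even-length lucky blocks of `π`. -/
noncomputable def luckyEvenBlocks {n : ℕ} (π : Fin (2*n) → Fin (2*n)) : ℕ :=
  (blocks π).countP (fun p => decide (Even p.1 ∧ IsLuckyEnd π p.2))

theorem List.count_one_zipWith_sub (L : List ℕ) (p : ℕ) (h : (p :: L).Pairwise (· < ·)) :
    (List.zipWith (fun x y => x - y) L (p :: L)).count 1
      = L.countP (fun y => decide (∃ z ∈ p :: L, y = z + 1)) := by
  induction L generalizing p with
  | nil => simp
  | cons x L ih =>
    have h' := List.pairwise_cons.1 h
    have h2 := List.pairwise_cons.1 h'.2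
    have hpx : p < x := h'.1 x (by simp)
    rw [List.zipWith_cons_cons, List.count_cons, ih x h'.2, List.countP_cons]
    congr 1
    · apply List.countP_congr
      intro y hy
      have := h2.1 y hy
      simp only [decide_eq_true_eq, List.mem_cons, exists_eq_or_imp]
      constructor
      · exact Or.inr
      · rintro (h | h)
        · omega
        · exact h
    · have : (x - p = 1) ↔ (∃ z ∈ p :: x :: L, x = z + 1) := by
        constructor
        · intro h
          exact ⟨p, by simp, by omega⟩
        · rintro ⟨z, hz, rfl⟩
          rcases List.mem_cons.1 hz with rfl | hz
          · omega
          · rcases List.mem_cons.1 hz with hz | hz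
            · omega
            · have := h2.1 z hz
              omega
      simp only [beq_iff_eq, this, decide_eq_true_eq]

theorem count_one_blockLens {n : ℕ} (π : Fin (2*n) → Fin (2*n)) :
    (blockLens π).count 1
      = (Finset.univ.filter fun j : Fin (2*n) =>
          π j < j ∧ ∃ i : Fin (2*n), π i < i ∧ (j : ℕ) = i + 1).card := by
  have hmem (j : Fin (2*n)) : j ∈ blockEnds π ↔ π j < j := by simp [blockEnds]
  have hsort : (blockEnds π).Pairwise (· < ·) := Finset.sortedLT_sort _ |>.pairwise
  have hcoe : (do let a ← blockEnds π; pure (a : ℕ)) = (blockEnds π).map Fin.val := by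
    simp [List.map_eq_flatMap]
  unfold blockLens
  rw [hcoe, List.map_map, List.count_one_zipWith_sub, List.countP_map, List.countP_eq_length_filter,
    ← List.toFinset_card_of_nodup]
  · congr 1
    ext j
    simp only [List.mem_toFinset, List.mem_filter, hmem, Function.comp, decide_eq_true_eq,
      List.mem_cons, List.mem_map, Finset.mem_filter, Finset.mem_univ, true_and]
    refine and_congr_right fun hj => ?_
    constructor
    · rintro ⟨z, rfl | ⟨i, hi, rfl⟩, h⟩
      · have : (π j : ℕ) < j := hj
        omega
      · exact ⟨i, hi, by omega⟩
    · rintro ⟨i, hi, h⟩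
      exact ⟨i + 1, Or.inr ⟨i, hi, rfl⟩, by omega⟩
  · exact (hsort.imp (fun h => ne_of_lt h)).filter _
  · rw [List.pairwise_cons, List.pairwise_map]
    refine ⟨by simp, hsort.imp fun {a b} h => ?_⟩
    exact Nat.succ_lt_succ h

theorem mem_deals {n : ℕ} {π : Fin (2*n) → Fin (2*n)} : π ∈ deals n ↔ IsDeal n π := by
  simp [deals]

theorem deals_card_pos (n : ℕ) : 0 < (deals n).card := by
  refine Finset.card_pos.2 ⟨Fin.rev, mem_deals.2 fun j => ⟨Fin.rev_rev j, fun h => ?_⟩⟩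
  have := congrArg Fin.val h
  rw [Fin.val_rev] at this
  omega

theorem IsDeal.conj {n : ℕ} {π : Fin (2*n) → Fin (2*n)} (h : IsDeal n π)
    (e : Equiv.Perm (Fin (2*n))) : IsDeal n (fun j => e (π (e.symm j))) := by
  intro j
  simp only [Equiv.symm_apply_apply, (h _).1, Equiv.apply_symm_apply, true_and]
  intro hj
  exact (h (e.symm j)).2 (by rw [Equiv.eq_symm_apply, hj])

/-- The number of deals of size `n` that pair `a` with `x` and `b` with `y`. -/
noncomputable def dealsThrough {n : ℕ} (a x b y : Fin (2*n)) : ℕ :=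
  ((deals n).filter fun π => π a = x ∧ π b = y).card

theorem dealsThrough_perm {n : ℕ} (e : Equiv.Perm (Fin (2*n))) (a x b y : Fin (2*n)) :
    dealsThrough (e a) (e x) (e b) (e y) = dealsThrough a x b y := by
  symm
  refine Finset.card_nbij' (fun π j => e (π (e.symm j))) (fun π j => e.symm (π (e j)))
    ?_ ?_ ?_ ?_
  · intro π hπ
    simp only [Finset.coe_filter, Set.mem_ofPred_eq, mem_deals] at hπ ⊢
    exact ⟨hπ.1.conj e, by simp [hπ.2.1], by simp [hπ.2.2]⟩
  · intro π hπ
    simp only [Finset.coe_filter, Set.mem_ofPred_eq, mem_deals] at hπ ⊢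
    exact ⟨hπ.1.conj e.symm, by simp [hπ.2.1], by simp [hπ.2.2]⟩
  · intro π _
    simp
  · intro π _
    simp

theorem dealsThrough_eq {n : ℕ} {a x b y a' x' b' y' : Fin (2*n)}
    (h : [a, x, b, y].Nodup) (h' : [a', x', b', y'].Nodup) :
    dealsThrough a' x' b' y' = dealsThrough a x b y := by
  have hinj {a x b y : Fin (2*n)} (h : [a, x, b, y].Nodup) :
      Function.Injective ![a, x, b, y] := by
    rw [← List.nodup_ofFn]
    simpa using h
  obtain ⟨e, he⟩ := Equiv.Perm.exists_extending_pair _ _ (hinj h) (hinj h')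
  obtain ⟨h0, h1, h2, h3⟩ : e a = a' ∧ e x = x' ∧ e b = b' ∧ e y = y' :=
    ⟨he 0, he 1, he 2, he 3⟩
  rw [← dealsThrough_perm e a x b y, h0, h1, h2, h3]

theorem exists_dealsThrough_eq (n : ℕ) :
    ∃ c, ∀ a x b y : Fin (2*n), [a, x, b, y].Nodup → dealsThrough a x b y = c := by
  by_cases h : ∃ a x b y : Fin (2*n), [a, x, b, y].Nodup
  · obtain ⟨a, x, b, y, h⟩ := h
    exact ⟨_, fun _ _ _ _ h' => dealsThrough_eq h h'⟩
  · exact ⟨0, fun a x b y h' => (h ⟨a, x, b, y, h'⟩).elim⟩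

theorem card_deals_pair {n c : ℕ}
    (hc : ∀ a x b y : Fin (2*n), [a, x, b, y].Nodup → dealsThrough a x b y = c)
    (hn : 2 ≤ n) {a x : Fin (2*n)} (hax : x ≠ a) :
    ((deals n).filter fun π => π a = x).card = (2*n - 3) * c := by
  obtain ⟨b, hb⟩ : ∃ b, b ∉ ({a, x} : Finset (Fin (2*n))) := by
    by_contra! h
    have h1 := Finset.card_le_card (fun i _ => h i : Finset.univ ⊆ ({a, x} : Finset (Fin (2*n))))
    have h2 := Finset.card_le_two (a := a) (b := x)
    simp only [Finset.card_univ, Fintype.card_fin] at h1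
    omega
  simp only [Finset.mem_insert, Finset.mem_singleton, not_or] at hb
  have hcard : ({a, x, b} : Finset (Fin (2*n)))ᶜ.card = 2*n - 3 := by
    rw [Finset.card_compl, Fintype.card_fin, Finset.card_eq_three.2
      ⟨a, x, b, hax.symm, Ne.symm hb.1, Ne.symm hb.2, rfl⟩]
  rw [← hcard, Finset.card_eq_sum_card_fiberwise
    (f := fun π => π b) (t := ({a, x, b} : Finset (Fin (2*n)))ᶜ)]
  · refine Finset.sum_const_nat fun y hy => ?_
    simp only [Finset.mem_compl, Finset.mem_insert, Finset.mem_singleton, not_or] at hy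
    rw [Finset.filter_filter]
    exact hc a x b y (by simp; grind)
  · intro π hπ
    simp only [Finset.coe_filter, Set.mem_ofPred_eq, mem_deals] at hπ
    have h1 := hπ.1 a
    have h2 := hπ.1 b
    simp only [Finset.coe_compl, Set.mem_compl_iff, Finset.mem_coe, Finset.mem_insert,
      Finset.mem_singleton, not_or]
    grind

theorem card_deals_eq {n c : ℕ}
    (hc : ∀ a x b y : Fin (2*n), [a, x, b, y].Nodup → dealsThrough a x b y = c)
    (hn : 2 ≤ n) : (deals n).card = (2*n - 1) * ((2*n - 3) * c) := by
  have a : Fin (2*n) := ⟨0, by omega⟩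
  have hcard : ({a} : Finset (Fin (2*n)))ᶜ.card = 2*n - 1 := by
    rw [Finset.card_compl, Fintype.card_fin, Finset.card_singleton]
  rw [← hcard, Finset.card_eq_sum_card_fiberwise
    (f := fun π => π a) (t := ({a} : Finset (Fin (2*n)))ᶜ)]
  · exact Finset.sum_const_nat fun x hx => card_deals_pair hc hn (by simpa using hx)
  · intro π hπ
    simpa using (mem_deals.1 hπ a).2

theorem card_deals_adjacent {n c : ℕ}
    (hc : ∀ a x b y : Fin (2*n), [a, x, b, y].Nodup → dealsThrough a x b y = c)
    (j : Fin (2*n)) :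
    ((deals n).filter fun π => π j < j ∧ ∃ i : Fin (2*n), π i < i ∧ (j : ℕ) = i + 1).card
      = (j - 1) * (j - 2) * c := by
  rcases Nat.eq_zero_or_pos (j : ℕ) with hj | hj
  · simp [hj]
  obtain ⟨i, hi⟩ : ∃ i : Fin (2*n), (j : ℕ) = i + 1 :=
    ⟨⟨j - 1, by omega⟩, by simp; omega⟩
  have hcard : (Finset.Iio i).offDiag.card = (j - 1) * (j - 2 : ℕ) := by
    rw [Finset.offDiag_card, Fin.card_Iio, hi, ← Nat.mul_sub_one]
    rfl
  rw [← hcard, Finset.card_eq_sum_card_fiberwise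
    (f := fun π => (π i, π j)) (t := (Finset.Iio i).offDiag)]
  · refine Finset.sum_const_nat fun ⟨x, y⟩ hxy => ?_
    simp only [Finset.mem_offDiag, Finset.mem_Iio, Fin.lt_def] at hxy
    rw [Finset.filter_filter, ← hc i x j y (by simp [Fin.ext_iff]; grind)]
    unfold dealsThrough
    congr 1
    refine Finset.filter_congr fun π _ => ?_
    simp only [Prod.mk.injEq]
    refine ⟨fun h => h.2, fun h => ⟨⟨?_, i, ?_, hi⟩, h⟩⟩
    · rw [h.2, Fin.lt_def]; omega
    · rw [h.1, Fin.lt_def]; omega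
  · intro π hπ
    simp only [Finset.coe_filter, Set.mem_ofPred_eq, mem_deals] at hπ
    obtain ⟨hd, hj', k, hk, hjk⟩ := hπ
    obtain rfl : k = i := Fin.ext (by omega)
    have h1 := hd k
    have h2 := hd j
    simp only [Finset.mem_coe, Finset.mem_offDiag, Finset.mem_Iio]
    have h3 : π j ≠ k := by
      intro h
      rw [h] at h2
      rw [h2.1, Fin.lt_def] at hk
      omega
    refine ⟨hk, ?_, fun h => ?_⟩
    · rw [Fin.lt_def] at hj' ⊢
      rw [Ne, Fin.ext_iff] at h3
      omega
    · have : k = j := by rw [← h1.1, h, h2.1]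
      rw [this] at hjk
      omega

theorem sum_range_pred_mul_pred (m : ℕ) :
    3 * ∑ j ∈ Finset.range (m + 1), (j - 1) * (j - 2) = m * (m - 1) * (m - 2) := by
  induction m with
  | zero => simp
  | succ m ih =>
    rw [Finset.sum_range_succ, mul_add, ih]
    rcases m with _ | _ | m
    · simp
    · simp
    · simp only [Nat.add_sub_cancel, show m + 1 + 1 - 1 = m + 1 by omega,
        show m + 1 + 1 + 1 - 2 = m + 1 by omega, show m + 1 + 1 - 2 = m by omega]
      ring

theorem three_mul_bcount_one (n : ℕ) (hn : 1 ≤ n) :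
    3 * bcount n 1 = (2*n - 2) * (deals n).card := by
  obtain ⟨c, hc⟩ := exists_dealsThrough_eq n
  have key : bcount n 1 = (∑ j ∈ Finset.range (2*n), (j - 1) * (j - 2)) * c := by
    simp only [bcount, count_one_blockLens, Finset.card_filter]
    rw [Finset.sum_comm, ← Fin.sum_univ_eq_sum_range (fun j => (j - 1) * (j - 2)),
      Finset.sum_mul]
    refine Finset.sum_congr rfl fun j _ => ?_
    rw [← Finset.card_filter, card_deals_adjacent hc]
  have hsum := sum_range_pred_mul_pred (2*n - 1)
  rw [show 2*n - 1 + 1 = 2*n by omega] at hsum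
  rw [key, ← mul_assoc, hsum]
  rcases hn.eq_or_lt with rfl | hn
  · simp
  · rw [card_deals_eq hc hn, show 2*n - 1 - 1 = 2*n - 2 by omega,
      show 2*n - 1 - 2 = 2*n - 3 by omega]
    ring

/-- For `n ≥ 1`, `eb(n,1) = (2n-2)/3`; equivalently, `db(n,1) = -1`. -/
theorem eb_one (n : ℕ) (hn : 1 ≤ n) :
    eb n 1 = (2*(n:ℝ) - 2)/3 ∧ db n 1 = -1 := by
  have hpos : (0 : ℝ) < (deals n).card := by exact_mod_cast deals_card_pos n
  have h : (3 : ℝ) * bcount n 1 = (2*n - 2) * (deals n).card := by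
    have := congrArg (Nat.cast (R := ℝ)) (three_mul_bcount_one n hn)
    rw [Nat.cast_mul, Nat.cast_mul, Nat.cast_sub (by omega)] at this
    exact_mod_cast this
  have heb : eb n 1 = (2*(n:ℝ) - 2)/3 := by
    rw [eb, div_eq_div_iff hpos.ne' three_ne_zero]
    linarith
  refine ⟨heb, ?_⟩
  rw [db, heb]
  norm_num
  ring
end

section
/- For every integer n ≥ 2, db(n,3) = 2·db(n,2) = 3/(2(2n−1)); equivalently, eb(n,3) = (2n+1)/30 + 3/(2(2n−1)). -/
open scoped Classical

/-- The involutions of `α` whose set of non-fixed points is exactly `S`. -/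
noncomputable def involutionsOn {α : Type*} [Fintype α] [DecidableEq α] (S : Finset α) :
    Finset (α → α) :=
  Finset.univ.filter fun f => ∀ x, f (f x) = x ∧ (f x ≠ x ↔ x ∈ S)

/-- The number of perfect matchings of a set with `m` elements. -/
def matchingCount : ℕ → ℕ
  | 0 => 1
  | 1 => 0
  | m + 2 => (m + 1) * matchingCount m

section Involutions

variable {α : Type*} [Fintype α] [DecidableEq α]

theorem mem_involutionsOn {S : Finset α} {f : α → α} :
    f ∈ involutionsOn S ↔ ∀ x, f (f x) = x ∧ (f x ≠ x ↔ x ∈ S) := by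
  simp [involutionsOn]

theorem swap_comp_mem_involutionsOn_erase {S : Finset α} {f : α → α} {a b : α}
    (hf : f ∈ involutionsOn S) (hab : f a = b) :
    Equiv.swap a b ∘ f ∈ involutionsOn ((S.erase a).erase b) := by
  rw [mem_involutionsOn] at *
  have hba : f b = a := by rw [← hab]; exact (hf a).1
  intro x
  simp only [Function.comp_apply, Finset.mem_erase]
  by_cases hxa : x = a
  · subst hxa; simp [hab]
  by_cases hxb : x = b
  · subst hxb; simp [hba]
  have h1 : f x ≠ a := fun h => hxb (by rw [← (hf x).1, h, hab])
  have h2 : f x ≠ b := fun h => hxa (by rw [← (hf x).1, h, hba])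
  rw [Equiv.swap_apply_of_ne_of_ne h1 h2, (hf x).1, Equiv.swap_apply_of_ne_of_ne hxa hxb]
  exact ⟨rfl, by simp [hxa, hxb, (hf x).2]⟩

theorem swap_comp_mem_involutionsOn {S : Finset α} {g : α → α} {a b : α}
    (ha : a ∈ S) (hb : b ∈ S) (hne : a ≠ b)
    (hg : g ∈ involutionsOn ((S.erase a).erase b)) :
    Equiv.swap a b ∘ g ∈ involutionsOn S ∧ (Equiv.swap a b ∘ g) a = b := by
  rw [mem_involutionsOn] at *
  have hga : g a = a := by
    by_contra h; have := ((hg a).2.1 h); simp at this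
  have hgb : g b = b := by
    by_contra h; have := ((hg b).2.1 h); simp at this
  refine ⟨fun x => ?_, by simp [hga]⟩
  simp only [Function.comp_apply]
  by_cases hxa : x = a
  · subst hxa; simp [hga, hgb, hne.symm, ha]
  by_cases hxb : x = b
  · subst hxb; simp [hga, hgb, hne, hb]
  have h1 : g x ≠ a := fun h => hxa (by rw [← (hg x).1, h, hga])
  have h2 : g x ≠ b := fun h => hxb (by rw [← (hg x).1, h, hgb])
  rw [Equiv.swap_apply_of_ne_of_ne h1 h2, (hg x).1, Equiv.swap_apply_of_ne_of_ne hxa hxb]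
  exact ⟨rfl, by simpa [hxa, hxb] using (hg x).2⟩

/-- Fixing one pair `{a, b}` of an involution removes it from the support; the remaining
constraint, that the elements of `A` are sent to `B`, is unaffected. -/
theorem card_involutionsOn_filter_apply_eq {S A B : Finset α} {a b : α}
    (ha : a ∈ S) (haA : a ∉ A) (hb : b ∈ S)
    (hbA : b ∉ A) (hne : a ≠ b) :
    ((involutionsOn S).filter fun f => f a = b ∧ ∀ x ∈ A, f x ∈ B).card =
      ((involutionsOn ((S.erase a).erase b)).filter
        fun f => ∀ x ∈ A, f x ∈ B.erase b).card := by
  refine Finset.card_nbij' (fun f => Equiv.swap a b ∘ f) (fun f => Equiv.swap a b ∘ f)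
    ?_ ?_ ?_ ?_
  · intro f hf
    simp only [Finset.coe_filter, Set.mem_ofPred_eq] at hf ⊢
    obtain ⟨hf, hab, hAf⟩ := hf
    refine ⟨swap_comp_mem_involutionsOn_erase hf hab, fun x hx => ?_⟩
    rw [mem_involutionsOn] at hf
    have hba : f b = a := by rw [← hab]; exact (hf a).1
    have h1 : f x ≠ a := fun h => hbA (by rw [← hab, ← h, (hf x).1]; exact hx)
    have h2 : f x ≠ b := fun h => haA (by rw [← hba, ← h, (hf x).1]; exact hx)
    simp [Equiv.swap_apply_of_ne_of_ne h1 h2, h2, hAf x hx]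
  · intro g hg
    simp only [Finset.coe_filter, Set.mem_ofPred_eq] at hg ⊢
    obtain ⟨hg, hAg⟩ := hg
    obtain ⟨h, h'⟩ := swap_comp_mem_involutionsOn ha hb hne hg
    refine ⟨h, h', fun x hx => ?_⟩
    rw [mem_involutionsOn] at hg
    have hga : g a = a := by
      by_contra h; have := ((hg a).2.1 h); simp at this
    have h1 : g x ≠ a := fun h => haA (by rw [← hga, ← h, (hg x).1]; exact hx)
    have h2 := Finset.mem_erase.1 (hAg x hx)
    simpa [Equiv.swap_apply_of_ne_of_ne h1 h2.1] using h2.2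
  · intro f _; ext x; simp
  · intro f _; ext x; simp

theorem card_involutionsOn (S : Finset α) :
    (involutionsOn S).card = matchingCount S.card := by
  induction hm : S.card using Nat.strong_induction_on generalizing S with
  | _ m ih =>
    rcases S.eq_empty_or_nonempty with rfl | ⟨a, ha⟩
    · obtain rfl : m = 0 := by simpa using hm.symm
      rw [matchingCount, Finset.card_eq_one]
      refine ⟨id, Finset.ext fun f => ?_⟩
      simp only [mem_involutionsOn, Finset.mem_singleton, Finset.notMem_empty, iff_false,
        not_not]
      exact ⟨fun h => funext fun x => (h x).2, by rintro rfl; simp⟩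
    have hpair : ∀ b ∈ S.erase a,
        ((involutionsOn S).filter fun f => f a = b).card = matchingCount (m - 2) := by
      intro b hb
      have hb' := Finset.mem_erase.1 hb
      have h := card_involutionsOn_filter_apply_eq (A := ∅) (B := ∅) (S := S) (a := a) (b := b)
        ha (by simp) hb'.2 (by simp) hb'.1.symm
      simp only [Finset.notMem_empty, false_imp_iff, implies_true, and_true,
        Finset.filter_true] at h
      have hc : ((S.erase a).erase b).card = m - 2 := by
        rw [Finset.card_erase_of_mem hb, Finset.card_erase_of_mem ha]; omega
      have := Finset.card_pos.2 ⟨a, ha⟩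
      rw [h, ih (m - 2) (by omega) _ hc]
    have hmap : ∀ f ∈ involutionsOn S, f a ∈ S.erase a := by
      intro f hf
      rw [mem_involutionsOn] at hf
      have h1 := (hf a).2.2 ha
      exact Finset.mem_erase.2 ⟨h1, (hf (f a)).2.1 (by rw [(hf a).1]; exact h1.symm)⟩
    rw [Finset.card_eq_sum_card_fiberwise hmap, Finset.sum_congr rfl hpair, Finset.sum_const,
      Finset.card_erase_of_mem ha, hm, smul_eq_mul]
    match m, hm with
    | 0, hm => exact absurd ha (by simp [Finset.card_eq_zero.1 hm])
    | 1, _ => simp [matchingCount]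
    | m + 2, _ => simp [matchingCount]

/-- The number of perfect matchings of `S` that match every element of `A` to an element
of `B`. -/
theorem card_involutionsOn_filter_mapsTo {S A B : Finset α} (hA : A ⊆ S) (hB : B ⊆ S)
    (hAB : Disjoint A B) :
    ((involutionsOn S).filter fun f => ∀ x ∈ A, f x ∈ B).card =
      B.card.descFactorial A.card * matchingCount (S.card - 2 * A.card) := by
  induction A using Finset.induction_on generalizing S B with
  | empty => simp [card_involutionsOn]
  | insert a A haA ih =>
    obtain ⟨haS, hAS⟩ := Finset.insert_subset_iff.1 hA
    obtain ⟨haB, hAB⟩ := Finset.disjoint_insert_left.1 hAB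
    have hpair : ∀ b ∈ B, (((involutionsOn S).filter fun f => ∀ x ∈ insert a A, f x ∈ B).filter
        fun f => f a = b).card =
          (B.card - 1).descFactorial A.card * matchingCount (S.card - 2 * (A.card + 1)) := by
      intro b hb
      have hbA : b ∉ A := fun h => Finset.disjoint_left.1 hAB h hb
      have hne : a ≠ b := by rintro rfl; exact haB hb
      have hfilter : (((involutionsOn S).filter fun f => ∀ x ∈ insert a A, f x ∈ B).filter
          fun f => f a = b) =
            (involutionsOn S).filter fun f => f a = b ∧ ∀ x ∈ A, f x ∈ B := by
        ext f
        simp only [Finset.mem_filter, Finset.forall_mem_insert]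
        constructor
        · rintro ⟨⟨h1, -, h2⟩, h3⟩; exact ⟨h1, h3, h2⟩
        · rintro ⟨h1, rfl, h2⟩; exact ⟨⟨h1, hb, h2⟩, rfl⟩
      rw [hfilter, card_involutionsOn_filter_apply_eq haS haA (hB hb) hbA hne, ih,
        Finset.card_erase_of_mem hb, Finset.card_erase_of_mem
          (Finset.mem_erase.2 ⟨hne.symm, hB hb⟩), Finset.card_erase_of_mem haS]
      · congr 2; omega
      · intro x hx
        refine Finset.mem_erase.2 ⟨?_, Finset.mem_erase.2 ⟨?_, hAS hx⟩⟩
        · rintro rfl; exact hbA hx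
        · rintro rfl; exact haA hx
      · intro x hx
        obtain ⟨h1, h2⟩ := Finset.mem_erase.1 hx
        refine Finset.mem_erase.2 ⟨h1, Finset.mem_erase.2 ⟨?_, hB h2⟩⟩
        rintro rfl; exact haB h2
      · exact hAB.mono_right (Finset.erase_subset _ _)
    have hmap : ∀ f ∈ (involutionsOn S).filter fun f => ∀ x ∈ insert a A, f x ∈ B,
        f a ∈ B := fun f hf => (Finset.mem_filter.1 hf).2 a (Finset.mem_insert_self _ _)
    rw [Finset.card_eq_sum_card_fiberwise hmap, Finset.sum_congr rfl hpair, Finset.sum_const,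
      smul_eq_mul, Finset.card_insert_of_notMem haA]
    cases B.card with
    | zero => simp
    | succ c => rw [Nat.succ_descFactorial_succ]; simp [mul_assoc]

end Involutions

theorem deals_eq_involutionsOn (n : ℕ) : deals n = involutionsOn Finset.univ := by
  ext f
  simp [deals, IsDeal, mem_involutionsOn]

theorem card_deals_s11 (n : ℕ) : (deals n).card = matchingCount (2 * n) := by
  simp [deals_eq_involutionsOn, card_involutionsOn]

/-- The number of deals in which the `k` positions before position `m` are all first
occurrences. -/
theorem card_deals_filter_window (n : ℕ) {k m : ℕ} (hkm : k ≤ m) (hm : m ≤ 2 * n) :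
    ((deals n).filter fun π => ∀ i : Fin (2 * n), (i : ℕ) < m → m ≤ i + k → i < π i).card =
      (2 * n - m).descFactorial k * matchingCount (2 * n - 2 * k) := by
  set A : Finset (Fin (2 * n)) := Finset.univ.filter fun i => (i : ℕ) < m ∧ m ≤ i + k with hA
  set B : Finset (Fin (2 * n)) := Finset.univ.filter fun i => m ≤ (i : ℕ) with hB
  have hAcard : A.card = k := by
    have : A.map Fin.valEmbedding = Finset.Ico (m - k) m := by
      ext x
      simp only [hA, Finset.mem_map, Finset.mem_filter, Finset.mem_univ, true_and,
        Fin.valEmbedding_apply, Finset.mem_Ico]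
      constructor
      · rintro ⟨i, hi, rfl⟩; omega
      · intro hx; exact ⟨⟨x, by omega⟩, by simp; omega, rfl⟩
    rw [← Finset.card_map Fin.valEmbedding, this, Nat.card_Ico]; omega
  have hBcard : B.card = 2 * n - m := by
    have : B.map Fin.valEmbedding = Finset.Ico m (2 * n) := by
      ext x
      simp only [hB, Finset.mem_map, Finset.mem_filter, Finset.mem_univ, true_and,
        Fin.valEmbedding_apply, Finset.mem_Ico]
      constructor
      · rintro ⟨i, hi, rfl⟩; omega
      · intro hx; exact ⟨⟨x, by omega⟩, by simp; omega, rfl⟩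
    rw [← Finset.card_map Fin.valEmbedding, this, Nat.card_Ico]
  have hdisj : Disjoint A B := by
    rw [Finset.disjoint_left]
    intro x hx hx'
    simp only [hA, hB, Finset.mem_filter, Finset.mem_univ, true_and] at hx hx'
    omega
  have h := card_involutionsOn_filter_mapsTo A.subset_univ B.subset_univ hdisj
  rw [hAcard, hBcard, Finset.card_univ, Fintype.card_fin, ← deals_eq_involutionsOn] at h
  rw [← h]
  congr 1
  ext π
  refine Finset.mem_filter.trans (Iff.trans (and_congr_right fun hπ => ?_)
    (@Finset.mem_filter _ _ (_) _ _).symm)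
  have hπ' : IsDeal n π := by simpa [deals] using hπ
  simp only [hA, hB, Finset.mem_filter, Finset.mem_univ, true_and, and_imp]
  constructor
  · intro h i h1 h2
    by_contra h3
    have := h (π i) (by omega) (by have := h i h1 h2; rw [Fin.lt_def] at this; omega)
    rw [(hπ' i).1] at this
    exact absurd (h i h1 h2) this.not_gt
  · intro h i h1 h2
    have := h i h1 h2
    rw [Fin.lt_def]
    omega

/-- Among the gaps of a strictly increasing list, starting from `y`, those exceeding `k` are
those preceded by `k` consecutive missing values. -/
theorem countP_lt_zipWith_sub (k y : ℕ) (l : List ℕ) (hl : (y :: l).Pairwise (· < ·)) :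
    (List.zipWith (fun x y => x - y) l (y :: l)).countP (fun b => decide (k < b)) =
      l.countP fun x => decide (y + k < x ∧ ∀ z ∈ l, z < x → z + k < x) := by
  induction l generalizing y with
  | nil => simp
  | cons a t ih =>
    rw [List.pairwise_cons] at hl
    obtain ⟨hy, ht⟩ := hl
    have hya : y < a := hy a (by simp)
    have hat : ∀ x ∈ t, a < x := (List.pairwise_cons.1 ht).1
    rw [List.zipWith_cons_cons, List.countP_cons, List.countP_cons, ih a ht]
    congr 1
    · refine List.countP_congr fun x hx => ?_
      have := hat x hx
      simp only [decide_eq_true_eq, List.forall_mem_cons]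
      constructor
      · rintro ⟨h1, h2⟩; exact ⟨by omega, fun _ => h1, h2⟩
      · rintro ⟨h1, h2, h3⟩; exact ⟨h2 this, h3⟩
    · have : (k < a - y) ↔ (y + k < a ∧ ∀ z ∈ a :: t, z < a → z + k < a) := by
        rw [List.forall_mem_cons]
        constructor
        · intro h
          exact ⟨by omega, by omega, fun z hz hza => absurd (hat z hz) hza.not_gt⟩
        · rintro ⟨h, -⟩; omega
      simp only [this]

theorem countP_lt_blockLens {n : ℕ} (k : ℕ) (π : Fin (2 * n) → Fin (2 * n)) :
    (blockLens π).countP (fun b => decide (k < b)) =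
      (Finset.univ.filter fun j : Fin (2 * n) =>
        π j < j ∧ k ≤ (j : ℕ) ∧ ∀ z, π z < z → z < j → (z : ℕ) + k < j).card := by
  have hmem : ∀ j, j ∈ blockEnds π ↔ π j < j := by simp [blockEnds]
  have hlens : blockLens π = List.zipWith (fun x y => x - y)
      ((blockEnds π).map fun j : Fin (2 * n) => (j : ℕ) + 1)
      (0 :: (blockEnds π).map fun j : Fin (2 * n) => (j : ℕ) + 1) := by
    simp [blockLens, Function.comp_def, ← List.map_eq_flatMap]
  have hsorted : (0 :: (blockEnds π).map fun j : Fin (2 * n) => (j : ℕ) + 1).Pairwise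
      (· < ·) := by
    rw [List.pairwise_cons]
    refine ⟨by simp, List.pairwise_map.2 ?_⟩
    refine List.Pairwise.imp ?_
      (Finset.sortedLT_sort (Finset.univ.filter fun j => π j < j)).pairwise
    intro a b hab
    exact Nat.succ_lt_succ hab
  have hnodup : (blockEnds π).Nodup := Finset.sort_nodup _ _
  rw [hlens, countP_lt_zipWith_sub k 0 _ hsorted, List.countP_map, List.countP_eq_length_filter,
    ← List.toFinset_card_of_nodup (hnodup.filter _)]
  congr 1
  ext j
  simp only [List.mem_toFinset, List.mem_filter, hmem, Function.comp_apply, decide_eq_true_eq,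
    List.forall_mem_map, Finset.mem_filter, Finset.mem_univ, true_and]
  refine and_congr_right fun _ => and_congr (by omega) (forall_congr' fun z =>
    imp_congr_right fun _ => imp_congr ?_ ?_)
  · rw [Fin.lt_def]; omega
  · omega

theorem countP_lt_blockLens_add_card_windows {n : ℕ} (k : ℕ) {π : Fin (2 * n) → Fin (2 * n)}
    (hπ : π ∈ deals n) :
    (blockLens π).countP (fun b => decide (k < b)) +
      (Finset.univ.filter fun j : Fin (2 * n) => k ≤ (j : ℕ) ∧
        ∀ i : Fin (2 * n), (i : ℕ) < j + 1 → (j : ℕ) + 1 ≤ i + (k + 1) → i < π i).card =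
      (Finset.univ.filter fun j : Fin (2 * n) => k ≤ (j : ℕ) ∧
        ∀ i : Fin (2 * n), (i : ℕ) < j → (j : ℕ) ≤ i + k → i < π i).card := by
  have hπ' : IsDeal n π := by simpa [deals] using hπ
  have hlt : ∀ i, ¬ π i < i ↔ i < π i := fun i =>
    ⟨fun h => lt_of_le_of_ne (not_lt.1 h) (hπ' i).2.symm, fun h => h.not_gt⟩
  rw [countP_lt_blockLens, ← Finset.card_filter_add_card_filter_not (fun j => π j < j) (s :=
    Finset.univ.filter fun j : Fin (2 * n) => k ≤ (j : ℕ) ∧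
      ∀ i : Fin (2 * n), (i : ℕ) < j → (j : ℕ) ≤ i + k → i < π i),
    Finset.filter_filter, Finset.filter_filter]
  congr 2
  · refine Finset.filter_congr fun j _ => ?_
    rw [and_comm, and_assoc, and_assoc]
    refine and_congr_right fun _ => ?_
    rw [and_comm (b := π j < j), and_comm (a := π j < j)]
    refine and_congr_left fun _ => forall_congr' fun z => ?_
    rw [← hlt z, ← Fin.lt_def, ← not_lt]
    tauto
  · refine Finset.filter_congr fun j _ => ?_
    rw [hlt j, and_assoc]
    refine and_congr_right fun hk => ⟨fun h => ⟨fun i h1 h2 => h i (by omega) (by omega),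
      h j (by omega) (by omega)⟩, fun ⟨h, hj⟩ i h1 h2 => ?_⟩
    rcases eq_or_ne i j with rfl | hne
    · exact hj
    · have := Fin.val_ne_of_ne hne
      exact h i (by omega) (by omega)

theorem succ_mul_sum_range_descFactorial (k M : ℕ) :
    (k + 1) * ∑ i ∈ Finset.range M, i.descFactorial k = M.descFactorial (k + 1) := by
  induction M with
  | zero => simp
  | succ M ih =>
    rw [Finset.sum_range_succ, mul_add, ih, Nat.succ_descFactorial_succ, Nat.descFactorial_succ,
      ← add_mul]
    rcases lt_or_ge M k with h | h
    · simp [Nat.descFactorial_of_lt h]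
    · congr 1; omega

theorem sum_Ico_descFactorial_sub_succ (k N : ℕ) :
    (k + 2) * ∑ j ∈ Finset.Ico k N, (N - (j + 1)).descFactorial (k + 1) =
      (N - k).descFactorial (k + 2) := by
  rw [← succ_mul_sum_range_descFactorial, Finset.sum_Ico_eq_sum_range,
    ← Finset.sum_range_reflect (fun i => i.descFactorial (k + 1))]
  congr 1
  refine Finset.sum_congr rfl fun i _ => ?_
  congr 1; omega

theorem sum_Ico_descFactorial_sub (k N : ℕ) :
    (k + 2) * ∑ j ∈ Finset.Ico (k + 1) N, (N - j).descFactorial (k + 1) =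
      (N - k).descFactorial (k + 2) := by
  rw [← sum_Ico_descFactorial_sub_succ,
    Finset.sum_Ico_add' (fun j => (N - j).descFactorial (k + 1)) k N 1]
  congr 1
  rcases le_or_gt N k with h | h
  · rw [Finset.Ico_eq_empty (by omega), Finset.Ico_eq_empty (by omega)]
  · rw [Finset.sum_Ico_succ_top (by omega)]
    simp

/-- For `k ≥ 1`, this is `k + 1` times the number of pairs of a deal and a position such that the `k` positions before it exist
and are first occurrences. -/
def windowTotal (n k : ℕ) : ℕ :=
  (2 * n - (k - 1)).descFactorial (k + 1) * matchingCount (2 * n - 2 * k)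

theorem sum_card_windows (n k c : ℕ) (hc : c ≤ 1) :
    ∑ π ∈ deals n, (Finset.univ.filter fun j : Fin (2 * n) => k ≤ (j : ℕ) ∧
        ∀ i : Fin (2 * n), (i : ℕ) < j + c → (j : ℕ) + c ≤ i + (k + c) → i < π i).card =
      (∑ j ∈ Finset.Ico k (2 * n), (2 * n - (j + c)).descFactorial (k + c)) *
        matchingCount (2 * n - 2 * (k + c)) := by
  have hswap := Finset.sum_card_bipartiteAbove_eq_sum_card_bipartiteBelow (s := deals n)
    (t := Finset.univ) (fun π (j : Fin (2 * n)) => k ≤ (j : ℕ) ∧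
      ∀ i : Fin (2 * n), (i : ℕ) < j + c → (j : ℕ) + c ≤ i + (k + c) → i < π i)
  simp only [Finset.bipartiteAbove, Finset.bipartiteBelow] at hswap
  have hIco : Finset.Ico k (2 * n) = (Finset.range (2 * n)).filter (k ≤ ·) := by
    ext; simp [and_comm]
  rw [hswap, hIco, Finset.sum_filter, ← Fin.sum_univ_eq_sum_range
    (fun j => if k ≤ j then (2 * n - (j + c)).descFactorial (k + c) else 0), Finset.sum_mul]
  refine Finset.sum_congr rfl fun j _ => ?_
  by_cases hk : k ≤ (j : ℕ)
  · simp only [hk, true_and, if_true]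
    exact card_deals_filter_window n (by omega) (by omega)
  · simp [hk]

theorem sum_countP_lt_blockLens (n k : ℕ) :
    (k + 2) * (k + 3) * ∑ π ∈ deals n, (blockLens π).countP (fun b => decide (k + 1 < b)) +
      (k + 2) * windowTotal n (k + 2) = (k + 3) * windowTotal n (k + 1) := by
  have h := Finset.sum_congr rfl fun π hπ => countP_lt_blockLens_add_card_windows (n := n) (k + 1)
    (π := π) hπ
  rw [Finset.sum_add_distrib, sum_card_windows n (k + 1) 1 le_rfl] at h
  have h0 := sum_card_windows n (k + 1) 0 zero_le_one
  simp only [add_zero] at h0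
  rw [h0] at h
  have h1 := sum_Ico_descFactorial_sub k (2 * n)
  have h2 := sum_Ico_descFactorial_sub_succ (k + 1) (2 * n)
  simp only [windowTotal, Nat.add_sub_cancel, show k + 2 - 1 = k + 1 by omega, ← h2,
    show k + 1 + 1 = k + 2 by omega, ← h1] at h ⊢
  linear_combination (k + 2) * (k + 3) * h

theorem bcount_succ_add (n k : ℕ) :
    bcount n (k + 1) + ∑ π ∈ deals n, (blockLens π).countP (fun b => decide (k + 1 < b)) =
      ∑ π ∈ deals n, (blockLens π).countP (fun b => decide (k < b)) := by
  rw [bcount, ← Finset.sum_add_distrib]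
  refine Finset.sum_congr rfl fun π _ => ?_
  induction blockLens π with
  | nil => simp
  | cons a t ih =>
    simp only [List.count_cons, List.countP_cons, ← ih, beq_iff_eq, decide_eq_true_eq]
    split_ifs <;> omega

theorem matchingCount_two_mul_pos (n : ℕ) : 0 < matchingCount (2 * n) := by
  induction n with
  | zero => simp [matchingCount]
  | succ n ih => rw [Nat.mul_succ, matchingCount]; positivity

theorem bcount_two (n : ℕ) :
    12 * bcount n 2 + 8 * windowTotal n 2 = 6 * windowTotal n 1 + 3 * windowTotal n 3 := by
  have h1 := sum_countP_lt_blockLens n 0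
  have h2 := sum_countP_lt_blockLens n 1
  have h3 := bcount_succ_add n 1
  norm_num at h1 h2 h3
  omega

theorem bcount_three (n : ℕ) :
    60 * bcount n 3 + 30 * windowTotal n 3 = 20 * windowTotal n 2 + 12 * windowTotal n 4 := by
  have h1 := sum_countP_lt_blockLens n 1
  have h2 := sum_countP_lt_blockLens n 2
  have h3 := bcount_succ_add n 2
  norm_num at h1 h2 h3
  omega

/-- Closed forms of the window totals, relative to the number of deals. -/
theorem windowTotal_closed_forms {n : ℕ} (hn : 2 ≤ n) :
    (windowTotal n 1 : ℝ) = 2 * n * matchingCount (2 * n) ∧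
    (windowTotal n 2 : ℝ) = (2 * n - 2) * matchingCount (2 * n) ∧
    (windowTotal n 3 : ℝ) * (2 * n - 1) = 4 * (n - 1) * (n - 2) * matchingCount (2 * n) ∧
    (windowTotal n 4 : ℝ) * (2 * n - 1) = 4 * (n - 2) * (n - 3) * matchingCount (2 * n) := by
  obtain rfl | rfl | ⟨m, rfl⟩ : n = 2 ∨ n = 3 ∨ ∃ m, n = m + 4 := by
    by_cases h2 : n = 2
    · exact .inl h2
    · by_cases h3 : n = 3
      · exact .inr (.inl h3)
      · exact .inr (.inr ⟨n - 4, by omega⟩)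
  · norm_num [windowTotal, matchingCount, Nat.descFactorial]
  · norm_num [windowTotal, matchingCount, Nat.descFactorial]
  · have e0 : 2 * (m + 4) = 2 * m + 8 := by ring
    simp only [windowTotal, e0, show 2 * m + 8 - 2 * 1 = 2 * m + 6 by omega,
      show 2 * m + 8 - 2 * 2 = 2 * m + 4 by omega, show 2 * m + 8 - 2 * 3 = 2 * m + 2 by omega,
      show 2 * m + 8 - 2 * 4 = 2 * m by omega, show 2 * m + 8 - (1 - 1) = 2 * m + 8 by omega,
      show 2 * m + 8 - (2 - 1) = 2 * m + 7 by omega,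
      show 2 * m + 8 - (4 - 1) = 2 * m + 5 by omega, matchingCount,
      Nat.succ_descFactorial_succ, Nat.descFactorial_zero]
    push_cast
    refine ⟨?_, ?_, ?_, ?_⟩ <;> ring

/-- For `n ≥ 2`, `db(n,3) = 2·db(n,2) = 3/(2(2n-1))`; equivalently,
`eb(n,3) = (2n+1)/30 + 3/(2(2n-1))`. -/
theorem db_three (n : ℕ) (hn : 2 ≤ n) :
    db n 3 = 2 * db n 2 ∧ db n 3 = 3/(2*(2*(n:ℝ)-1)) ∧
      eb n 3 = (2*(n:ℝ)+1)/30 + 3/(2*(2*(n:ℝ)-1)) := by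
  obtain ⟨w1, w2, w3, w4⟩ := windowTotal_closed_forms hn
  have hn' : (2 : ℝ) ≤ n := by exact_mod_cast hn
  have hd : (2 * (n : ℝ) - 1) ≠ 0 := by linarith
  have hE : (matchingCount (2 * n) : ℝ) ≠ 0 := by
    exact_mod_cast (matchingCount_two_mul_pos n).ne'
  have b2 : (12 * bcount n 2 + 8 * windowTotal n 2 : ℝ) =
      6 * windowTotal n 1 + 3 * windowTotal n 3 := by exact_mod_cast bcount_two n
  have b3 : (60 * bcount n 3 + 30 * windowTotal n 3 : ℝ) =
      20 * windowTotal n 2 + 12 * windowTotal n 4 := by exact_mod_cast bcount_three n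
  have e2 : eb n 2 = (2*(n:ℝ)+1)/12 + 3/(4*(2*(n:ℝ)-1)) := by
    rw [eb, card_deals_s11]
    field_simp
    linear_combination 4 * (2 * (n : ℝ) - 1) * b2 + 24 * (2 * (n : ℝ) - 1) * w1 + 12 * w3
      - 32 * (2 * (n : ℝ) - 1) * w2
  have e3 : eb n 3 = (2*(n:ℝ)+1)/30 + 3/(2*(2*(n:ℝ)-1)) := by
    rw [eb, card_deals_s11]
    field_simp
    linear_combination (2 * (n : ℝ) - 1) * b3 + 20 * (2 * (n : ℝ) - 1) * w2 + 12 * w4 - 30 * w3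
  refine ⟨?_, ?_, e3⟩
  · rw [db, db, e2, e3]; push_cast; field_simp; ring
  · rw [db, e3]; push_cast; field_simp; ring
end
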